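/- arXiv:2008.07567 — 2 statements merged into one kernel-verified Lean document; each statement's English description precedes it below -/
import Mathlib

section
/- Let N ≥ 1 and let d be a divisor of N such that N/d is odd. Then the number of admissible N-tuples that are d-periodic (λ_{(k+d) mod N} = λ_k for all k) equals 2^{d−1}. -/
/-- An admissible `N`-tuple: `λ : Fin N → ℕ` with `∑ (λᵢ + 1) = 2N` and every consecutive
sum `∑_{k=i}^{j} (λₖ + 1) ≠ N` for `i ≤ j`. -/
def Admissible (N : ℕ) (lam : Fin N → ℕ) : Prop :=
  (∑ i, (lam i + 1)) = 2 * N ∧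
  ∀ i j : Fin N, i ≤ j → (∑ k ∈ Finset.Icc i j, (lam k + 1)) ≠ N

/-- `λ` is `d`-periodic: `λ_{(k+d) mod N} = λ_k` for all `k`. -/
def IsPeriodic (N d : ℕ) (lam : Fin N → ℕ) : Prop :=
  ∀ k : Fin N, lam ⟨((k : ℕ) + d) % N, Nat.mod_lt _ (Nat.zero_lt_of_lt k.isLt)⟩ = lam k

/-- The normalized strictly increasing sequences that advance by `2d` over `d` steps
and never have two terms at distance `d`. -/
def IsBalancedSeq (d : ℕ) (s : ℕ → ℕ) : Prop :=
  StrictMono s ∧ s 0 = 0 ∧ (∀ k, s (k + d) = s k + 2 * d) ∧ ∀ i j, s j ≠ s i + d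

/-- The sets of natural numbers containing `0` and alternating under translation by `d`. -/
def IsAlternatingSet (d : ℕ) (P : Set ℕ) : Prop :=
  0 ∈ P ∧ ∀ x, x + d ∈ P ↔ x ∉ P

/-! ### Counting alternating sets -/

theorem IsAlternatingSet.ext {d : ℕ} (hd : 0 < d) {P Q : Set ℕ} (hP : IsAlternatingSet d P)
    (hQ : IsAlternatingSet d Q) (h : ∀ x, x + 1 < d → (x + 1 ∈ P ↔ x + 1 ∈ Q)) : P = Q := by
  ext x
  induction x using Nat.strong_induction_on with
  | _ x ih =>
    rcases lt_or_ge x d with hx | hx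
    · rcases x with _ | x
      · simp [hP.1, hQ.1]
      · exact h x hx
    · obtain ⟨y, rfl⟩ := Nat.exists_eq_add_of_le' hx
      rw [hP.2, hQ.2, ih y (by omega)]

theorem isAlternatingSet_setOf_even_iff {d : ℕ} (hd : 0 < d) {B : ℕ → Prop} (hB : B 0) :
    IsAlternatingSet d {x | Even (x / d) ↔ B (x % d)} := by
  refine ⟨by simpa using hB, fun x => ?_⟩
  simp only [Set.mem_ofPred_eq, Nat.add_div_right x hd, Nat.add_mod_right, Nat.even_add_one]
  tauto

theorem card_isAlternatingSet {d : ℕ} (hd : 0 < d) :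
    Nat.card {P : Set ℕ // IsAlternatingSet d P} = 2 ^ (d - 1) := by
  have hbij : Function.Bijective
      (fun (P : {P : Set ℕ // IsAlternatingSet d P}) =>
        ({i | (i : ℕ) + 1 ∈ P.1} : Set (Fin (d - 1)))) := by
    constructor
    · rintro ⟨P, hP⟩ ⟨Q, hQ⟩ h
      refine Subtype.ext (hP.ext hd hQ fun x hx => ?_)
      exact Set.ext_iff.1 h ⟨x, by omega⟩
    · intro T
      refine ⟨⟨_, isAlternatingSet_setOf_even_iff hd
        (B := fun x => x = 0 ∨ ∃ i ∈ T, (i : ℕ) + 1 = x) (Or.inl rfl)⟩, ?_⟩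
      ext i
      have hi : (i : ℕ) + 1 < d := by omega
      simp only [Set.mem_ofPred_eq, Nat.div_eq_of_lt hi, Nat.mod_eq_of_lt hi]
      simp [Fin.val_inj]
  rw [Nat.card_eq_of_bijective _ hbij]
  simp

/-! ### Alternating sets and balanced sequences -/

open Classical in
theorem IsAlternatingSet.count_add {d : ℕ} {P : Set ℕ} (hP : IsAlternatingSet d P) (x : ℕ) :
    Nat.count (· ∈ P) (x + 2 * d) = Nat.count (· ∈ P) x + d := by
  have key : ∀ n, Nat.count (fun k => x + k ∈ P) n + Nat.count (fun k => x + (d + k) ∈ P) n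
      = n := by
    intro n
    induction n with
    | zero => simp
    | succ n ih =>
      have h := hP.2 (x + n)
      rw [show x + n + d = x + (d + n) by omega] at h
      rw [Nat.count_succ, Nat.count_succ]
      split_ifs <;> first | omega | tauto
  rw [Nat.count_add, two_mul, Nat.count_add, key]

theorem IsAlternatingSet.infinite {d : ℕ} (hd : 0 < d) {P : Set ℕ} (hP : IsAlternatingSet d P) :
    P.Infinite := by
  refine Set.infinite_of_forall_exists_gt fun a => ?_
  by_cases h : a + 1 ∈ P
  · exact ⟨_, h, by omega⟩
  · exact ⟨_, (hP.2 _).2 h, by omega⟩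

theorem IsAlternatingSet.isBalancedSeq_nth {d : ℕ} (hd : 0 < d) {P : Set ℕ}
    (hP : IsAlternatingSet d P) : IsBalancedSeq d (Nat.nth (· ∈ P)) := by
  classical
  have hinf : (Set.ofPred (· ∈ P)).Infinite := hP.infinite hd
  refine ⟨Nat.nth_strictMono hinf, Nat.nth_zero_of_zero hP.1, fun k => ?_, fun i j h => ?_⟩
  · have hmem : Nat.nth (· ∈ P) k + 2 * d ∈ P := by
      rw [two_mul, ← add_assoc, hP.2, hP.2, not_not]
      exact Nat.nth_mem_of_infinite hinf k
    have hc := hP.count_add (Nat.nth (· ∈ P) k)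
    rw [Nat.count_nth_of_infinite hinf] at hc
    rw [← hc]
    exact Nat.nth_count (p := (· ∈ P)) hmem
  · have hj : Nat.nth (· ∈ P) j ∈ P := Nat.nth_mem_of_infinite hinf j
    rw [h, hP.2] at hj
    exact hj (Nat.nth_mem_of_infinite hinf i)

theorem StrictMono.nth_mem_range {s : ℕ → ℕ} (hs : StrictMono s) :
    Nat.nth (· ∈ Set.range s) = s := by
  have hinf : (Set.ofPred (· ∈ Set.range s)).Infinite := Set.infinite_range_of_injective hs.injective
  refine (StrictMono.range_inj (Nat.nth_strictMono hinf) hs).1 ?_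
  rw [Nat.range_nth_of_infinite hinf]
  rfl

theorem IsBalancedSeq.add_two_mul_mem_range {d : ℕ} {s : ℕ → ℕ} (hs : IsBalancedSeq d s) (x : ℕ) :
    x + 2 * d ∈ Set.range s ↔ x ∈ Set.range s := by
  obtain ⟨hmono, h0, hper, -⟩ := hs
  constructor
  · rintro ⟨k, hk⟩
    have hd := hper 0
    have hle : d ≤ k := by
      rw [← hmono.le_iff_le]
      simp only [zero_add] at hd
      omega
    obtain ⟨j, rfl⟩ := Nat.exists_eq_add_of_le' hle
    exact ⟨j, by have := hper j; omega⟩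
  · rintro ⟨k, rfl⟩
    exact ⟨k + d, hper k⟩

open Classical in
theorem IsBalancedSeq.count_add {d : ℕ} {s : ℕ → ℕ} (hs : IsBalancedSeq d s) (x : ℕ) :
    Nat.count (· ∈ Set.range s) (x + 2 * d) = Nat.count (· ∈ Set.range s) x + d := by
  induction x with
  | zero =>
    have hinf : (Set.ofPred (· ∈ Set.range s)).Infinite :=
      Set.infinite_range_of_injective hs.1.injective
    have h := Nat.count_nth_of_infinite hinf d
    rw [hs.1.nth_mem_range] at h
    have hd := hs.2.2.1 0
    rw [zero_add, hs.2.1] at hd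
    rw [← hd, h, Nat.count_zero, zero_add]
  | succ x ih =>
    rw [add_right_comm, Nat.count_succ, Nat.count_succ, ih]
    simp only [hs.add_two_mul_mem_range]
    omega

theorem IsBalancedSeq.isAlternatingSet_range {d : ℕ} (hd : 0 < d) {s : ℕ → ℕ}
    (hs : IsBalancedSeq d s) : IsAlternatingSet d (Set.range s) := by
  classical
  refine ⟨⟨0, hs.2.1⟩, fun x => ⟨?_, fun hx => ?_⟩⟩
  · rintro ⟨j, hj⟩ ⟨i, rfl⟩
    exact hs.2.2.2 i j hj
  · by_contra hxd
    have key : ∀ n, Nat.count (fun k => x + k ∈ Set.range s) (n + 1)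
        + Nat.count (fun k => x + (d + k) ∈ Set.range s) (n + 1) ≤ n := by
      intro n
      induction n with
      | zero => simp_all [Nat.count_succ]
      | succ n ih =>
        have h : x + (n + 1) ∈ Set.range s → x + (d + (n + 1)) ∉ Set.range s := by
          rintro ⟨i, hi⟩ ⟨j, hj⟩
          exact hs.2.2.2 i j (by omega)
        rw [Nat.count_succ _ (n + 1), Nat.count_succ _ (n + 1)]
        split_ifs <;> first | omega | tauto
    have hc := hs.count_add x
    rw [Nat.count_add, two_mul, Nat.count_add] at hc
    have := key (d - 1)
    rw [Nat.sub_add_cancel hd] at this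
    omega

/-- Balanced sequences are the increasing enumerations of alternating sets. -/
noncomputable def balancedSeqEquivAlternatingSet {d : ℕ} (hd : 0 < d) :
    {s : ℕ → ℕ // IsBalancedSeq d s} ≃ {P : Set ℕ // IsAlternatingSet d P} where
  toFun s := ⟨Set.range s.1, s.2.isAlternatingSet_range hd⟩
  invFun P := ⟨Nat.nth (· ∈ P.1), P.2.isBalancedSeq_nth hd⟩
  left_inv s := Subtype.ext s.2.1.nth_mem_range
  right_inv P := Subtype.ext (Nat.range_nth_of_infinite (P.2.infinite hd))

/-! ### Periodic admissible tuples and balanced sequences -/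

theorem IsBalancedSeq.add_mul {d : ℕ} {s : ℕ → ℕ} (hs : IsBalancedSeq d s) (k q : ℕ) :
    s (k + d * q) = s k + 2 * (d * q) := by
  induction q with
  | zero => simp
  | succ q ih => rw [mul_add_one, ← add_assoc, hs.2.2.1, ih]; ring

/-- The gaps, diminished by one, of the first `N + 1` terms of a sequence. -/
def gapTuple (N : ℕ) (s : ℕ → ℕ) (k : Fin N) : ℕ := s (k + 1) - s k - 1

/-- The partial sums of the `N`-periodic extension of `k ↦ lam k + 1`. -/
def partialSum {N : ℕ} [NeZero N] (lam : Fin N → ℕ) (n : ℕ) : ℕ :=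
  ∑ k ∈ Finset.range n, (lam (Fin.ofNat N k) + 1)

theorem partialSum_succ {N : ℕ} [NeZero N] (lam : Fin N → ℕ) (n : ℕ) :
    partialSum lam (n + 1) = partialSum lam n + (lam (Fin.ofNat N n) + 1) :=
  Finset.sum_range_succ _ _

theorem partialSum_strictMono {N : ℕ} [NeZero N] (lam : Fin N → ℕ) :
    StrictMono (partialSum lam) :=
  strictMono_nat_of_lt_succ fun n => by rw [partialSum_succ]; omega

theorem partialSum_self {N : ℕ} [NeZero N] (lam : Fin N → ℕ) :
    partialSum lam N = ∑ i, (lam i + 1) := by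
  rw [partialSum, ← Fin.sum_univ_eq_sum_range (fun k => lam (Fin.ofNat N k) + 1)]
  simp

theorem partialSum_add_sum_Icc {N : ℕ} [NeZero N] (lam : Fin N → ℕ) {i j : Fin N} (h : i ≤ j) :
    partialSum lam i + ∑ k ∈ Finset.Icc i j, (lam k + 1) = partialSum lam (j + 1) := by
  have hsum : ∑ k ∈ Finset.Icc i j, (lam k + 1)
      = ∑ k ∈ Finset.Ico (i : ℕ) (j + 1), (lam (Fin.ofNat N k) + 1) := by
    rw [Finset.Ico_add_one_right_eq_Icc, ← Fin.map_valEmbedding_Icc, Finset.sum_map]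
    simp
  rw [hsum]
  exact Finset.sum_range_add_sum_Ico _ (by have : (i : ℕ) ≤ j := h; omega)

theorem IsPeriodic.apply_ofNat_add {N d : ℕ} [NeZero N] {lam : Fin N → ℕ}
    (h : IsPeriodic N d lam) (k : ℕ) :
    lam (Fin.ofNat N (k + d)) = lam (Fin.ofNat N k) := by
  rw [← h (Fin.ofNat N k)]
  congr 1
  ext
  simp

theorem IsPeriodic.partialSum_add {N d : ℕ} [NeZero N] {lam : Fin N → ℕ}
    (h : IsPeriodic N d lam) (k : ℕ) :
    partialSum lam (k + d) = partialSum lam k + partialSum lam d := by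
  induction k with
  | zero => simp [partialSum]
  | succ k ih =>
    rw [add_right_comm, partialSum_succ, partialSum_succ, ih, h.apply_ofNat_add]
    omega

theorem Admissible.partialSum_ne {N : ℕ} [NeZero N] {lam : Fin N → ℕ} (h : Admissible N lam)
    {i j : ℕ} (hj : j ≤ N) : partialSum lam j ≠ partialSum lam i + N := by
  intro he
  have hN : 0 < N := Nat.pos_of_neZero N
  have hij : i < j := by
    rw [← (partialSum_strictMono lam).lt_iff_lt]
    omega
  have hle : (⟨i, by omega⟩ : Fin N) ≤ ⟨j - 1, by omega⟩ := by
    rw [Fin.mk_le_mk]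
    omega
  have hsum := partialSum_add_sum_Icc lam hle
  simp only [Nat.sub_add_cancel (by omega : 1 ≤ j)] at hsum
  exact h.2 _ _ hle (by omega)

theorem Admissible.isBalancedSeq_partialSum {N d q : ℕ} [NeZero N] (hN : N = d * (2 * q + 1))
    {lam : Fin N → ℕ} (h : Admissible N lam) (hp : IsPeriodic N d lam) :
    IsBalancedSeq d (partialSum lam) := by
  have hNpos : 0 < N := Nat.pos_of_neZero N
  have hmono := partialSum_strictMono lam
  have hmul (k t : ℕ) : partialSum lam (k + d * t) = partialSum lam k + partialSum lam d * t := by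
    induction t with
    | zero => simp
    | succ t ih => rw [mul_add_one, ← add_assoc, hp.partialSum_add, ih]; ring
  have hself : partialSum lam N = 2 * N := (partialSum_self lam).trans h.1
  have hd : partialSum lam d = 2 * d := by
    have h0 := hmul 0 (2 * q + 1)
    have hzero : partialSum lam 0 = 0 := Finset.sum_range_zero _
    have hN2 : 2 * N = 2 * d * (2 * q + 1) := by rw [hN, mul_assoc]
    rw [zero_add, ← hN, hself, hzero, zero_add, hN2] at h0
    exact (Nat.eq_of_mul_eq_mul_right (by omega) h0).symm
  rw [hd] at hmul
  have hmulN (k t : ℕ) : partialSum lam (k + N * t) = partialSum lam k + 2 * (N * t) := by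
    have hNt : N * t = d * ((2 * q + 1) * t) := by rw [hN, mul_assoc]
    rw [hNt, hmul, mul_assoc]
  refine ⟨hmono, by simp [partialSum], fun k => by rw [hp.partialSum_add, hd], fun i j he => ?_⟩
  obtain ⟨j', hj'⟩ : ∃ j', partialSum lam j' = partialSum lam i + N :=
    ⟨j + d * q, by rw [hmul, he]; linear_combination -hN⟩
  obtain ⟨i₀, j₀, hi₀, h₀⟩ : ∃ i₀ j₀, i₀ < N ∧ partialSum lam j₀ = partialSum lam i₀ + N := by
    have hij : i < j' := by rw [← hmono.lt_iff_lt]; omega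
    have hi := Nat.mod_add_div i N
    refine ⟨i % N, j' - N * (i / N), Nat.mod_lt _ hNpos, ?_⟩
    have h1 := hmulN (i % N) (i / N)
    have h2 := hmulN (j' - N * (i / N)) (i / N)
    rw [hi] at h1
    rw [Nat.sub_add_cancel (by omega)] at h2
    omega
  rcases le_or_gt j₀ N with hle | hgt
  · exact h.partialSum_ne hle h₀
  · obtain ⟨j₁, rfl⟩ := Nat.exists_eq_add_of_le' hgt.le
    have h1 := hmulN j₁ 1
    rw [mul_one] at h1
    exact h.partialSum_ne hi₀.le (i := j₁) (by omega)

theorem partialSum_gapTuple {N : ℕ} [NeZero N] {s : ℕ → ℕ} (hs : StrictMono s) (h0 : s 0 = 0)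
    (hper : ∀ k t, s (k + N * t) = s k + 2 * (N * t)) : partialSum (gapTuple N s) = s := by
  funext n
  induction n with
  | zero => simp [partialSum, h0]
  | succ n ih =>
    rw [partialSum_succ, ih, gapTuple, Fin.val_ofNat]
    have h1 := hper (n % N) (n / N)
    have h2 := hper (n % N + 1) (n / N)
    rw [add_right_comm, Nat.mod_add_div] at h2
    rw [Nat.mod_add_div] at h1
    have := hs (Nat.lt_succ_self (n % N))
    simp only [Nat.succ_eq_add_one] at this
    omega

theorem gapTuple_partialSum {N : ℕ} [NeZero N] (lam : Fin N → ℕ) :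
    gapTuple N (partialSum lam) = lam := by
  funext k
  rw [gapTuple, partialSum_succ, Fin.ofNat_val_eq_self]
  omega

theorem IsBalancedSeq.admissible_gapTuple {d q : ℕ} [NeZero (d * (2 * q + 1))] {s : ℕ → ℕ}
    (hs : IsBalancedSeq d s) : Admissible (d * (2 * q + 1)) (gapTuple (d * (2 * q + 1)) s) := by
  have hsum := partialSum_gapTuple (N := d * (2 * q + 1)) hs.1 hs.2.1
    fun k t => by rw [mul_assoc, hs.add_mul]
  refine ⟨?_, fun i j hij he => ?_⟩
  · rw [← partialSum_self, hsum, ← zero_add (d * _), hs.add_mul, hs.2.1]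
    ring
  · have h := partialSum_add_sum_Icc (gapTuple (d * (2 * q + 1)) s) hij
    rw [he, hsum] at h
    refine hs.2.2.2 (i + d * q) (j + 1) ?_
    rw [hs.add_mul, ← h]
    ring

theorem IsBalancedSeq.isPeriodic_gapTuple {d m : ℕ} {s : ℕ → ℕ} (hs : IsBalancedSeq d s) :
    IsPeriodic (d * m) d (gapTuple (d * m) s) := by
  intro k
  simp only [gapTuple]
  have h1 := hs.add_mul ((k + d) % (d * m)) (m * ((k + d) / (d * m)))
  have h2 := hs.add_mul ((k + d) % (d * m) + 1) (m * ((k + d) / (d * m)))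
  rw [add_right_comm, ← mul_assoc, Nat.mod_add_div, add_right_comm, hs.2.2.1] at h2
  rw [← mul_assoc, Nat.mod_add_div, hs.2.2.1] at h1
  omega

/-- Periodic admissible tuples correspond to balanced sequences through partial sums. -/
def periodicAdmissibleEquivBalancedSeq (d q : ℕ) [NeZero (d * (2 * q + 1))] :
    {lam : Fin (d * (2 * q + 1)) → ℕ //
      Admissible (d * (2 * q + 1)) lam ∧ IsPeriodic (d * (2 * q + 1)) d lam} ≃
    {s : ℕ → ℕ // IsBalancedSeq d s} where
  toFun lam := ⟨partialSum lam.1, lam.2.1.isBalancedSeq_partialSum rfl lam.2.2⟩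
  invFun s := ⟨gapTuple _ s.1, s.2.admissible_gapTuple, s.2.isPeriodic_gapTuple⟩
  left_inv lam := Subtype.ext (gapTuple_partialSum lam.1)
  right_inv s := Subtype.ext (partialSum_gapTuple s.2.1 s.2.2.1
    fun k t => by rw [mul_assoc, s.2.add_mul])

/-- for `d ∣ N` with `N/d` odd, the number of `d`-periodic admissible
`N`-tuples equals `2^(d-1)`. -/
theorem card_periodic_admissible (N d : ℕ) (hN : 1 ≤ N) (hd : d ∣ N)
    (hodd : Odd (N / d)) :
    Nat.card {lam : Fin N → ℕ // Admissible N lam ∧ IsPeriodic N d lam}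
      = 2 ^ (d - 1) := by
  have hdpos : 0 < d := Nat.pos_of_dvd_of_pos hd hN
  obtain ⟨q, hq⟩ := hodd
  obtain rfl : N = d * (2 * q + 1) := by rw [← hq, Nat.mul_div_cancel' hd]
  have : NeZero (d * (2 * q + 1)) := ⟨by omega⟩
  rw [Nat.card_congr (periodicAdmissibleEquivBalancedSeq d q),
    Nat.card_congr (balancedSeqEquivAlternatingSet hdpos), card_isAlternatingSet hdpos]
end

section
/- For every integer N ≥ 1, the number of aperiodic admissible N-tuples satisfies the lower bound A_N ≥ 2^{N−1} − ∑_{p odd prime, p ∣ N} 2^{N/p − 1}, where the sum ranges over the odd prime divisors of N. -/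
/-- `λ` is aperiodic: the only `d` with `1 ≤ d ≤ N` for which `λ` is `d`-periodic is
`d = N`. -/
def Aperiodic (N : ℕ) (lam : Fin N → ℕ) : Prop :=
  ∀ d : ℕ, 1 ≤ d → d ≤ N → IsPeriodic N d lam → d = N

/-- `A N` is the number of aperiodic admissible `N`-tuples. -/
noncomputable def numAperiodic (N : ℕ) : ℕ :=
  Nat.card {lam : Fin N → ℕ // Admissible N lam ∧ Aperiodic N lam}

/-- The `N`-periodic extension of `lam : Fin N → ℕ` to all natural numbers. -/
def cyclicExt {N : ℕ} [NeZero N] (lam : Fin N → ℕ) (k : ℕ) : ℕ := lam (Fin.ofNat N k)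

/-- The partial sums `∑_{i < k} (uᵢ + 1)`. -/
def shiftedSum (u : ℕ → ℕ) (k : ℕ) : ℕ := ∑ i ∈ Finset.range k, (u i + 1)

lemma shiftedSum_zero (u : ℕ → ℕ) : shiftedSum u 0 = 0 := rfl

lemma shiftedSum_succ (u : ℕ → ℕ) (k : ℕ) :
    shiftedSum u (k + 1) = shiftedSum u k + (u k + 1) :=
  Finset.sum_range_succ _ _

lemma shiftedSum_strictMono (u : ℕ → ℕ) : StrictMono (shiftedSum u) :=
  strictMono_nat_of_lt_succ fun k => by rw [shiftedSum_succ]; omega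

lemma shiftedSum_congr {u v : ℕ → ℕ} {k : ℕ} (h : ∀ i < k, u i = v i) :
    shiftedSum u k = shiftedSum v k :=
  Finset.sum_congr rfl fun i hi => by rw [h i (Finset.mem_range.mp hi)]

lemma shiftedSum_add_of_periodic {u : ℕ → ℕ} {d : ℕ} (hu : Function.Periodic u d) (k : ℕ) :
    shiftedSum u (k + d) = shiftedSum u k + shiftedSum u d := by
  induction k with
  | zero => simp [shiftedSum_zero]
  | succ k ih => rw [show k + 1 + d = k + d + 1 by ring, shiftedSum_succ, ih, hu k,
      shiftedSum_succ]; ring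

lemma shiftedSum_add_mul_of_periodic {u : ℕ → ℕ} {d : ℕ} (hu : Function.Periodic u d)
    (k m : ℕ) : shiftedSum u (k + m * d) = shiftedSum u k + m * shiftedSum u d := by
  induction m with
  | zero => simp
  | succ m ih => rw [show k + (m + 1) * d = k + m * d + d by ring,
      shiftedSum_add_of_periodic hu, ih]; ring

lemma shiftedSum_of_gaps {f : ℕ → ℕ} {u : ℕ → ℕ} {n : ℕ} (h0 : f 0 = 0)
    (hf : StrictMono f) (hu : ∀ i < n, u i = f (i + 1) - f i - 1) :
    ∀ k ≤ n, shiftedSum u k = f k := by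
  intro k
  induction k with
  | zero => intro _; rw [h0, shiftedSum_zero]
  | succ k ih =>
    intro hk
    have := hf k.lt_add_one
    rw [shiftedSum_succ, ih (by omega), hu k (by omega)]
    omega

section CyclicExt

variable {N : ℕ} [NeZero N] (lam : Fin N → ℕ)

lemma cyclicExt_val (i : Fin N) : cyclicExt lam i = lam i := by
  simp [cyclicExt]

lemma cyclicExt_periodic : Function.Periodic (cyclicExt lam) N := by
  intro k
  simp [cyclicExt, Fin.ofNat]

lemma isPeriodic_iff_cyclicExt (d : ℕ) :
    IsPeriodic N d lam ↔ Function.Periodic (cyclicExt lam) d := by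
  constructor
  · intro h k
    have := h (Fin.ofNat N k)
    simpa [cyclicExt, Fin.ofNat] using this
  · intro h k
    have := h k
    rw [cyclicExt_val] at this
    exact this

lemma shiftedSum_add_sum_Icc (i j : Fin N) (hij : i ≤ j) :
    shiftedSum (cyclicExt lam) i + ∑ k ∈ Finset.Icc i j, (lam k + 1) =
      shiftedSum (cyclicExt lam) (j + 1) := by
  have h : ∑ k ∈ Finset.Icc i j, (lam k + 1) =
      ∑ k ∈ Finset.Ico (i : ℕ) (j + 1), (cyclicExt lam k + 1) := by
    have e : Finset.Ico (i : ℕ) (j + 1) = (Finset.Icc i j).map Fin.valEmbedding := by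
      rw [Fin.map_valEmbedding_Icc]; ext; simp
    rw [e, Finset.sum_map]
    simp [cyclicExt_val]
  rw [h]
  exact Finset.sum_range_add_sum_Ico _ (by have : (i : ℕ) ≤ j := hij; omega)

lemma shiftedSum_cyclicExt_self :
    shiftedSum (cyclicExt lam) N = ∑ i, (lam i + 1) := by
  rw [shiftedSum, Finset.sum_range]
  simp [cyclicExt_val]

lemma admissible_iff_shiftedSum :
    Admissible N lam ↔ shiftedSum (cyclicExt lam) N = 2 * N ∧
      ∀ i j, i < j → j ≤ N →
        shiftedSum (cyclicExt lam) j ≠ shiftedSum (cyclicExt lam) i + N := by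
  rw [Admissible, shiftedSum_cyclicExt_self]
  refine and_congr_right fun _ => ⟨fun h i j hij hj e => ?_, fun h i j hij e => ?_⟩
  · obtain ⟨j, rfl⟩ : ∃ k, j = k + 1 := ⟨j - 1, by omega⟩
    have := shiftedSum_add_sum_Icc lam ⟨i, by omega⟩ ⟨j, by omega⟩
      (Fin.mk_le_mk.mpr (by omega))
    exact h ⟨i, by omega⟩ ⟨j, by omega⟩ (Fin.mk_le_mk.mpr (by omega)) (by simp at this; omega)
  · have := shiftedSum_add_sum_Icc lam i j hij
    have hij' : (i : ℕ) ≤ j := hij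
    exact h i (j + 1) (by omega) (by omega) (by omega)

end CyclicExt

/-- The partial sums of `lam` with index below `N`. -/
def partialSums {N : ℕ} [NeZero N] (lam : Fin N → ℕ) : Finset ℕ :=
  (Finset.range N).image (shiftedSum (cyclicExt lam))

lemma mem_partialSums {N : ℕ} [NeZero N] {lam : Fin N → ℕ} {x : ℕ} :
    x ∈ partialSums lam ↔ ∃ i < N, shiftedSum (cyclicExt lam) i = x := by
  simp [partialSums]

lemma Admissible.add_mem_partialSums_iff {N : ℕ} [NeZero N] {lam : Fin N → ℕ}
    (h : Admissible N lam) {x : ℕ} (hx : x < N) :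
    x + N ∈ partialSums lam ↔ x ∉ partialSums lam := by
  obtain ⟨h1, h2⟩ := (admissible_iff_shiftedSum lam).mp h
  set P := shiftedSum (cyclicExt lam)
  have hP : StrictMono P := shiftedSum_strictMono _
  have hlt : ∀ i < N, P i < 2 * N := fun i hi => h1 ▸ hP hi
  have hne : ∀ i j, i < N → j < N → P j ≠ P i + N := by
    intro i j hi hj e
    have hN := Nat.pos_of_neZero N
    exact h2 i j (hP.lt_iff_lt.mp (by omega)) hj.le e
  have hinj : Set.InjOn (fun i => P i % N) (Finset.range N) := by
    intro i hi j hj e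
    simp only [Finset.coe_range, Set.mem_Iio] at hi hj e
    have a := hlt i hi
    have b := hlt j hj
    have c := hne i j hi hj
    have d := hne j i hj hi
    apply hP.injective
    rcases lt_or_ge (P i) N with p | p <;> rcases lt_or_ge (P j) N with q | q
    · rwa [Nat.mod_eq_of_lt p, Nat.mod_eq_of_lt q] at e
    · rw [Nat.mod_eq_of_lt p, Nat.mod_eq_sub_mod q, Nat.mod_eq_of_lt (by omega)] at e; omega
    · rw [Nat.mod_eq_of_lt q, Nat.mod_eq_sub_mod p, Nat.mod_eq_of_lt (by omega)] at e; omega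
    · rw [Nat.mod_eq_sub_mod p, Nat.mod_eq_sub_mod q, Nat.mod_eq_of_lt (by omega),
        Nat.mod_eq_of_lt (by omega)] at e
      omega
  have himg : (Finset.range N).image (fun i => P i % N) = Finset.range N := by
    apply Finset.eq_of_subset_of_card_le
    · intro y hy
      obtain ⟨i, -, rfl⟩ := Finset.mem_image.mp hy
      exact Finset.mem_range.mpr (Nat.mod_lt _ (Nat.pos_of_neZero N))
    · rw [Finset.card_image_of_injOn hinj]
  rw [mem_partialSums, mem_partialSums]
  constructor
  · rintro ⟨j, hj, ej⟩ ⟨i, hi, ei⟩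
    exact hne i j hi hj (by change P j = _ at ej; change P i = _ at ei; omega)
  · intro hnot
    obtain ⟨i, hi, e⟩ := Finset.mem_image.mp (himg ▸ Finset.mem_range.mpr hx)
    have hi := Finset.mem_range.mp hi
    refine ⟨i, hi, ?_⟩
    have a := hlt i hi
    change P i = _
    have : P i ≠ x := fun e' => hnot ⟨i, hi, e'⟩
    rcases lt_or_ge (P i) N with p | p
    · rw [Nat.mod_eq_of_lt p] at e; omega
    · rw [Nat.mod_eq_sub_mod p, Nat.mod_eq_of_lt (by omega)] at e; omega

lemma Admissible.eq_of_partialSums_eq {N : ℕ} [NeZero N] {lam mu : Fin N → ℕ}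
    (hl : Admissible N lam) (hm : Admissible N mu)
    (h : partialSums lam = partialSums mu) : lam = mu := by
  have key : (fun i : Fin N => shiftedSum (cyclicExt lam) i) =
      fun i : Fin N => shiftedSum (cyclicExt mu) i := by
    have hs : ∀ u : ℕ → ℕ, StrictMono fun i : Fin N => shiftedSum u i :=
      fun u i j hij => shiftedSum_strictMono u hij
    refine ((hs _).range_inj (hs _)).mp ?_
    ext x
    have := Finset.ext_iff.mp h x
    simpa [mem_partialSums, Fin.exists_iff] using this
  have key' : ∀ i ≤ N, shiftedSum (cyclicExt lam) i = shiftedSum (cyclicExt mu) i := by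
    intro i hi
    rcases hi.lt_or_eq with hi | rfl
    · exact congrFun key ⟨i, hi⟩
    · rw [((admissible_iff_shiftedSum lam).mp hl).1, ((admissible_iff_shiftedSum mu).mp hm).1]
  funext i
  have a := key' i i.2.le
  have b := key' (i + 1) i.2
  rw [shiftedSum_succ, shiftedSum_succ, cyclicExt_val, cyclicExt_val] at b
  omega

/-- An admissible tuple is determined by its partial sums strictly between `0` and `N`. -/
lemma Admissible.eq_of_filter_eq {N : ℕ} [NeZero N] {lam mu : Fin N → ℕ}
    (hl : Admissible N lam) (hm : Admissible N mu)
    (h : (Finset.Ico 1 N).filter (· ∈ partialSums lam) =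
      (Finset.Ico 1 N).filter (· ∈ partialSums mu)) : lam = mu := by
  refine hl.eq_of_partialSums_eq hm ?_
  have zero_mem : ∀ nu : Fin N → ℕ, 0 ∈ partialSums nu := fun nu =>
    mem_partialSums.mpr ⟨0, Nat.pos_of_neZero N, shiftedSum_zero _⟩
  have lt_of_mem : ∀ {nu : Fin N → ℕ}, Admissible N nu → ∀ {x}, x ∈ partialSums nu →
      x < 2 * N := by
    intro nu hn x hx
    obtain ⟨i, hi, rfl⟩ := mem_partialSums.mp hx
    rw [← ((admissible_iff_shiftedSum nu).mp hn).1]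
    exact shiftedSum_strictMono _ hi
  have low : ∀ x < N, (x ∈ partialSums lam ↔ x ∈ partialSums mu) := by
    intro x hx
    rcases Nat.eq_zero_or_pos x with rfl | h0
    · simp [zero_mem]
    · have hx' : 1 ≤ x ∧ x < N := ⟨h0, hx⟩
      simpa [hx'] using Finset.ext_iff.mp h x
  ext x
  rcases lt_or_ge x N with hx | hx
  · exact low x hx
  · obtain ⟨y, rfl⟩ := Nat.exists_eq_add_of_le' hx
    by_cases hy : y < N
    · rw [hl.add_mem_partialSums_iff hy, hm.add_mem_partialSums_iff hy, low y hy]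
    · exact ⟨fun hx => absurd (lt_of_mem hl hx) (by omega),
        fun hx => absurd (lt_of_mem hm hx) (by omega)⟩

/-- Every subset of `{1, …, N - 1}` is the set of partial sums below `N` of some admissible
tuple. -/
lemma exists_admissible_filter_eq {N : ℕ} [NeZero N] {B : Finset ℕ}
    (hB : B ⊆ Finset.Ico 1 N) :
    ∃ lam : Fin N → ℕ, Admissible N lam ∧
      (Finset.Ico 1 N).filter (· ∈ partialSums lam) = B := by
  classical
  have hN := Nat.pos_of_neZero N
  obtain ⟨p, hp⟩ : ∃ p : ℕ → Prop, ∀ x, p x ↔ (x < N ∧ (x = 0 ∨ x ∈ B)) ∨ (N ≤ x ∧ x < 2 * N ∧ ¬(x - N = 0 ∨ x - N ∈ B)) ∨ 2 * N ≤ x :=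
    ⟨_, fun _ => Iff.rfl⟩
  have p_low : ∀ x < N, (p x ↔ x = 0 ∨ x ∈ B) := by
    intro x hx
    simp only [hp, hx, true_and, not_le.mpr hx, false_and, false_or]
    simp; omega
  have p_mid : ∀ x < N, (p (N + x) ↔ ¬ p x) := by
    intro x hx
    rw [p_low x hx, hp]
    simp only [Nat.add_sub_cancel_left]
    constructor
    · rintro (h | h | h)
      · omega
      · exact h.2.2
      · omega
    · intro h
      exact Or.inr (Or.inl ⟨by omega, by omega, h⟩)
  have p_high : ∀ x, 2 * N ≤ x → p x := fun x hx => (hp x).mpr (Or.inr (Or.inr hx))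
  have p_zero : p 0 := (p_low 0 hN).mpr (Or.inl rfl)
  have p_inf : {x | p x}.Infinite :=
    (Set.Ici_infinite (2 * N)).mono fun x hx => p_high x hx
  have count_eq : Nat.count p (2 * N) = N := by
    rw [two_mul, Nat.count_add, Nat.count_eq_card_filter_range, Nat.count_eq_card_filter_range,
      Finset.filter_congr (q := fun x => ¬ p x) fun x hx => p_mid x (Finset.mem_range.mp hx),
      Finset.card_filter_add_card_filter_not, Finset.card_range]
  have nth_N : Nat.nth p N = 2 * N := by
    conv_lhs => rw [← count_eq]
    exact Nat.nth_count (p_high _ le_rfl)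
  have nth_mono := Nat.nth_strictMono p_inf
  let lam : Fin N → ℕ := fun i => Nat.nth p (i + 1) - Nat.nth p i - 1
  have sum_eq : ∀ k ≤ N, shiftedSum (cyclicExt lam) k = Nat.nth p k :=
    shiftedSum_of_gaps (Nat.nth_zero_of_zero p_zero) nth_mono
      fun i hi => cyclicExt_val lam ⟨i, hi⟩
  refine ⟨lam, (admissible_iff_shiftedSum lam).mpr ⟨(sum_eq N le_rfl).trans nth_N, ?_⟩, ?_⟩
  · intro i j hij hj e
    rw [sum_eq i (by omega), sum_eq j hj] at e
    have pi := Nat.nth_mem_of_infinite p_inf i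
    have pj := Nat.nth_mem_of_infinite p_inf j
    have hj' : Nat.nth p j ≤ 2 * N := (nth_mono.monotone hj).trans_eq nth_N
    rcases lt_or_ge (Nat.nth p i) N with h | h
    · rw [e, add_comm] at pj
      exact (p_mid _ h).mp pj pi
    · have : Nat.nth p i = N + 0 := by omega
      rw [this] at pi
      exact (p_mid 0 hN).mp pi p_zero
  · ext x
    rw [Finset.mem_filter, mem_partialSums]
    constructor
    · rintro ⟨hx, i, hi, rfl⟩
      rw [sum_eq i hi.le] at hx ⊢
      rw [Finset.mem_Ico] at hx
      exact ((p_low _ hx.2).mp (Nat.nth_mem_of_infinite p_inf i)).resolve_left (by omega)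
    · intro hx
      have hx' := Finset.mem_Ico.mp (hB hx)
      have px : p x := (p_low x hx'.2).mpr (Or.inr hx)
      have hc : Nat.count p x < N := by
        apply nth_mono.lt_iff_lt.mp
        rw [Nat.nth_count px, nth_N]
        omega
      exact ⟨hB hx, _, hc, (sum_eq _ hc.le).trans (Nat.nth_count px)⟩

lemma bijOn_admissible (N : ℕ) [NeZero N] :
    Set.BijOn (fun lam : Fin N → ℕ => (Finset.Ico 1 N).filter (· ∈ partialSums lam))
      {lam | Admissible N lam} ((Finset.Ico 1 N).powerset : Set (Finset ℕ)) := by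
  refine ⟨fun lam _ => ?_, fun lam hl mu hm h => hl.eq_of_filter_eq hm h, fun B hB => ?_⟩
  · exact Finset.mem_coe.mpr (Finset.mem_powerset.mpr (Finset.filter_subset _ _))
  · exact exists_admissible_filter_eq (Finset.mem_powerset.mp (Finset.mem_coe.mp hB))

lemma finite_admissible (N : ℕ) [NeZero N] : {lam : Fin N → ℕ | Admissible N lam}.Finite :=
  (bijOn_admissible N).finite_iff_finite.mpr (Finset.finite_toSet _)

lemma ncard_admissible (N : ℕ) [NeZero N] :
    {lam : Fin N → ℕ | Admissible N lam}.ncard = 2 ^ (N - 1) := by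
  rw [← (bijOn_admissible N).injOn.ncard_image, (bijOn_admissible N).image_eq,
    Set.ncard_coe_finset, Finset.card_powerset, Nat.card_Ico]

lemma Function.Periodic.nat_gcd {α : Type*} {u : ℕ → α} {m n : ℕ}
    (hm : Function.Periodic u m) (hn : Function.Periodic u n) :
    Function.Periodic u (m.gcd n) := by
  let shift : (ℕ → α) → ℕ → α := fun v k => v (k + 1)
  have iter : ∀ n v k, shift^[n] v k = v (k + n) := by
    intro n
    induction n with
    | zero => intro v k; rfl
    | succ n ih =>
      intro v k
      rw [Function.iterate_succ_apply, ih]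
      exact congrArg v (by ring)
  have to_pt : ∀ {n}, Function.Periodic u n → Function.IsPeriodicPt shift n u :=
    fun {n} h => funext fun k => (iter n u k).trans (h k)
  intro k
  rw [← iter (m.gcd n) u k, ((to_pt hm).gcd (to_pt hn)).eq]

lemma Admissible.shiftedSum_of_periodic {N : ℕ} [NeZero N] {lam : Fin N → ℕ}
    (h : Admissible N lam) {m d : ℕ} (hd : m * d = N)
    (hp : Function.Periodic (cyclicExt lam) d) :
    shiftedSum (cyclicExt lam) d = 2 * d := by
  have hm : 0 < m := Nat.pos_of_ne_zero fun h0 => NeZero.ne N (by rw [← hd, h0, zero_mul])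
  have e := shiftedSum_add_mul_of_periodic hp 0 m
  rw [zero_add, hd, ((admissible_iff_shiftedSum lam).mp h).1, shiftedSum_zero, zero_add] at e
  exact Nat.eq_of_mul_eq_mul_left hm (by rw [← e]; linarith)

/-- The number of repetitions of a period in an admissible tuple is odd. -/
lemma Admissible.odd_of_periodic {N : ℕ} [NeZero N] {lam : Fin N → ℕ}
    (h : Admissible N lam) {m d : ℕ} (hd : m * d = N)
    (hp : Function.Periodic (cyclicExt lam) d) : Odd m := by
  by_contra hm
  obtain ⟨r, rfl⟩ := Nat.not_odd_iff_even.mp hm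
  have hN := Nat.pos_of_neZero N
  have e := shiftedSum_add_mul_of_periodic hp 0 r
  rw [h.shiftedSum_of_periodic hd hp] at e
  have hr : (r + r) * d = r * d + r * d := add_mul _ _ _
  refine ((admissible_iff_shiftedSum lam).mp h).2 0 (0 + r * d) (by omega) (by omega) ?_
  rw [e]
  linarith

lemma Admissible.exists_odd_prime_of_not_aperiodic {N : ℕ} [NeZero N] {lam : Fin N → ℕ}
    (h : Admissible N lam) (ha : ¬ Aperiodic N lam) :
    ∃ p ∈ N.primeFactors.filter (fun p => Odd p),
      Function.Periodic (cyclicExt lam) (N / p) := by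
  simp only [Aperiodic, not_forall] at ha
  obtain ⟨d, hd1, hdN, hper, hne⟩ := ha
  have hg := ((isPeriodic_iff_cyclicExt lam d).mp hper).nat_gcd (cyclicExt_periodic lam)
  have hgN : d.gcd N < N := (Nat.gcd_le_left N hd1).trans_lt (lt_of_le_of_ne hdN hne)
  obtain ⟨m, hm⟩ := Nat.gcd_dvd_right d N
  have hodd := h.odd_of_periodic (m := m) (by rw [mul_comm]; exact hm.symm) hg
  have hm1 : m ≠ 1 := by
    rintro rfl
    omega
  obtain ⟨r, hr⟩ := Nat.minFac_dvd m
  have hp := Nat.minFac_prime hm1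
  refine ⟨m.minFac, Finset.mem_filter.mpr ⟨Nat.mem_primeFactors.mpr
    ⟨hp, (Nat.minFac_dvd m).trans ⟨_, by rw [mul_comm]; exact hm⟩, NeZero.ne N⟩,
    hodd.of_dvd_nat (Nat.minFac_dvd m)⟩, ?_⟩
  have e : N / m.minFac = r * d.gcd N := by
    apply Nat.div_eq_of_eq_mul_right hp.pos
    conv_lhs => rw [hm, hr]
    ring
  rw [e]
  exact hg.nat_mul r

lemma Admissible.restrict {N d m : ℕ} [NeZero N] [NeZero d] {lam : Fin N → ℕ}
    (h : Admissible N lam) (hd : m * d = N) (hp : Function.Periodic (cyclicExt lam) d) :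
    Admissible d fun i => cyclicExt lam i := by
  have sum_eq : ∀ k ≤ d, shiftedSum (cyclicExt fun i : Fin d => cyclicExt lam i) k =
      shiftedSum (cyclicExt lam) k := fun k hk =>
    shiftedSum_congr fun i hi => cyclicExt_val (fun i : Fin d => cyclicExt lam i)
      ⟨i, by omega⟩
  refine (admissible_iff_shiftedSum _).mpr
    ⟨(sum_eq d le_rfl).trans (h.shiftedSum_of_periodic hd hp), fun i j hij hj e => ?_⟩
  rw [sum_eq i (by omega), sum_eq j hj] at e
  obtain ⟨r, rfl⟩ := h.odd_of_periodic hd hp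
  have hN : r * d + r * d + d = N := by rw [← hd]; ring
  refine ((admissible_iff_shiftedSum lam).mp h).2 i (j + r * d) (by omega) (by omega) ?_
  rw [shiftedSum_add_mul_of_periodic hp, e, h.shiftedSum_of_periodic hd hp]
  linarith

lemma ncard_admissible_periodic_le {N d m : ℕ} [NeZero N] (hd : m * d = N) :
    {lam : Fin N → ℕ | Admissible N lam ∧ Function.Periodic (cyclicExt lam) d}.ncard ≤
      2 ^ (d - 1) := by
  have : NeZero d := ⟨fun h0 => NeZero.ne N (by rw [← hd, h0, mul_zero])⟩
  rw [← ncard_admissible d]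
  refine Set.ncard_le_ncard_of_injOn (fun lam i => cyclicExt lam i)
    (fun lam h => h.1.restrict hd h.2) (fun lam hl mu hm e => ?_) (finite_admissible d)
  funext i
  have h := congrFun e ⟨i % d, Nat.mod_lt _ (Nat.pos_of_neZero d)⟩
  simp only [hl.2.map_mod_nat, hm.2.map_mod_nat, cyclicExt_val] at h
  exact h

/-- `A_N ≥ 2^(N-1) − ∑_{p odd prime, p ∣ N} 2^(N/p − 1)`. -/
theorem numAperiodic_lower_bound (N : ℕ) (hN : 1 ≤ N) :
    (2 : ℤ) ^ (N - 1) -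
        ∑ p ∈ N.primeFactors.filter (fun p => Odd p), (2 : ℤ) ^ (N / p - 1)
      ≤ (numAperiodic N : ℤ) := by
  have : NeZero N := ⟨by omega⟩
  let F := N.primeFactors.filter (fun p => Odd p)
  let A : Set (Fin N → ℕ) := {lam | Admissible N lam ∧ Aperiodic N lam}
  let Q : ℕ → Set (Fin N → ℕ) := fun p =>
    {lam | Admissible N lam ∧ Function.Periodic (cyclicExt lam) (N / p)}
  have hsub : {lam : Fin N → ℕ | Admissible N lam} ⊆ A ∪ ⋃ p ∈ F, Q p := by
    intro lam h
    by_cases ha : Aperiodic N lam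
    · exact Or.inl ⟨h, ha⟩
    · obtain ⟨p, hp, hper⟩ := h.exists_odd_prime_of_not_aperiodic ha
      exact Or.inr (Set.mem_biUnion hp ⟨h, hper⟩)
  have hfin : (A ∪ ⋃ p ∈ F, Q p).Finite :=
    (finite_admissible N).subset (Set.union_subset (fun _ h => h.1)
      (Set.iUnion₂_subset fun _ _ _ h => h.1))
  have hQ : ∀ p ∈ F, (Q p).ncard ≤ 2 ^ (N / p - 1) := fun p hp =>
    ncard_admissible_periodic_le
      (Nat.mul_div_cancel' (Nat.dvd_of_mem_primeFactors (Finset.mem_filter.mp hp).1))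
  have key : 2 ^ (N - 1) ≤ numAperiodic N + ∑ p ∈ F, 2 ^ (N / p - 1) := by
    calc 2 ^ (N - 1) = {lam : Fin N → ℕ | Admissible N lam}.ncard := (ncard_admissible N).symm
      _ ≤ (A ∪ ⋃ p ∈ F, Q p).ncard := Set.ncard_le_ncard hsub hfin
      _ ≤ A.ncard + (⋃ p ∈ F, Q p).ncard := Set.ncard_union_le _ _
      _ ≤ A.ncard + ∑ p ∈ F, (Q p).ncard :=
        Nat.add_le_add_left (Finset.set_ncard_biUnion_le F Q) _
      _ ≤ numAperiodic N + ∑ p ∈ F, 2 ^ (N / p - 1) :=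
        Nat.add_le_add (Nat.card_coe_set_eq A).ge (Finset.sum_le_sum hQ)
  rw [sub_le_iff_le_add]
  exact_mod_cast key
end
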